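/- Let d ≥ 1, let u : ℝᵈ → ℝ be C¹ and ℤᵈ-periodic, and let z : ℝᵈ → ℝᵈ be a C² ℤᵈ-periodic vector field such that |z(x)| ≤ 1 for every x and ∫ |∇u| ≤ ∫ z · ∇u. Then ∫ ∇u · ∇(div z) ≤ 0. -/

import Mathlib

open MeasureTheory
open scoped RealInnerProductSpace

noncomputable section

/-- The fundamental domain `[0,1)^d` of the torus, inside `ℝ^d`. -/
def UnitCube (d : ℕ) : Set (EuclideanSpace ℝ (Fin d)) :=
  {x | ∀ i, 0 ≤ x i ∧ x i < 1}

/-- A function on `ℝ^d` is `ℤ^d`-periodic if it is invariant under translations by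
integer vectors. -/
def ZdPeriodic {d : ℕ} {V : Type*} (f : EuclideanSpace ℝ (Fin d) → V) : Prop :=
  ∀ (x : EuclideanSpace ℝ (Fin d)) (m : Fin d → ℤ),
    f (x + (EuclideanSpace.equiv (Fin d) ℝ).symm (fun i => (m i : ℝ))) = f x

/-- The divergence of a vector field on `ℝ^d`. -/
noncomputable def diverg {d : ℕ}
    (z : EuclideanSpace ℝ (Fin d) → EuclideanSpace ℝ (Fin d))
    (x : EuclideanSpace ℝ (Fin d)) : ℝ :=
  ∑ i, fderiv ℝ z x (EuclideanSpace.single i 1) i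


lemma unitCube_eq (d : ℕ) : UnitCube d =
    ZSpan.fundamentalDomain (EuclideanSpace.basisFun (Fin d) ℝ).toBasis := by
  ext x
  simp [UnitCube, ZSpan.mem_fundamentalDomain]

open Pointwise in
lemma per_int_transl {d : ℕ} (F : EuclideanSpace ℝ (Fin d) → ℝ) (hF : ZdPeriodic F)
    (h : EuclideanSpace ℝ (Fin d)) :
    ∫ x in UnitCube d, F (x + h) = ∫ x in UnitCube d, F x := by
  have h1 := ZSpan.isAddFundamentalDomain' (EuclideanSpace.basisFun (Fin d) ℝ).toBasis
    (volume : Measure (EuclideanSpace ℝ (Fin d)))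
  rw [← unitCube_eq] at h1
  have h2 := h1.vadd_of_comm h
  have hcount : Countable (Submodule.span ℤ
      (Set.range (EuclideanSpace.basisFun (Fin d) ℝ).toBasis)).toAddSubgroup :=
    inferInstanceAs (Countable (Submodule.span ℤ
      (Set.range (EuclideanSpace.basisFun (Fin d) ℝ).toBasis)))
  have h3 := h1.setIntegral_eq h2 (f := F) (by
    rintro ⟨g, hg⟩ x
    rw [Submodule.mem_toAddSubgroup, Submodule.mem_span_range_iff_exists_fun] at hg
    obtain ⟨c, rfl⟩ := hg
    rw [← hF x c]
    congr 1
    change _ + x = _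
    rw [add_comm]
    congr 1
    ext i
    simp [Finset.sum_apply, Pi.single_apply])
  rw [h3]
  have h4 := (measurePreserving_add_right (volume : Measure (EuclideanSpace ℝ (Fin d))) h).setIntegral_preimage_emb
    (MeasurableEquiv.addRight h).measurableEmbedding F (h +ᵥ UnitCube d)
  rw [← h4]
  congr 2
  ext x
  simp [Set.mem_vadd_set, add_comm]

lemma cube_sub (d : ℕ) : UnitCube d ⊆ Metric.closedBall 0 d := by
  intro x hx
  simp only [Metric.mem_closedBall, dist_zero_right]
  rw [EuclideanSpace.norm_eq]
  apply Real.sqrt_le_iff.2 ⟨by positivity, ?_⟩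
  calc ∑ i, ‖x i‖ ^ 2 ≤ ∑ i : Fin d, (1 : ℝ) := by
        apply Finset.sum_le_sum
        intro i _
        have := hx i
        rw [Real.norm_eq_abs, sq_abs]
        nlinarith
    _ = d := by simp
    _ ≤ (d : ℝ) ^ 2 := by exact_mod_cast Nat.le_self_pow (by norm_num) d

lemma cube_int {d : ℕ} {F : EuclideanSpace ℝ (Fin d) → ℝ} (hF : Continuous F) :
    IntegrableOn F (UnitCube d) :=
  (hF.continuousOn.integrableOn_compact (isCompact_closedBall 0 (d : ℝ))).mono_set (cube_sub d)

lemma cube_fin (d : ℕ) : volume (UnitCube d) < ⊤ :=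
  (measure_mono (cube_sub d)).trans_lt (isCompact_closedBall 0 (d : ℝ)).measure_lt_top

lemma cube_meas (d : ℕ) : MeasurableSet (UnitCube d) := by
  rw [unitCube_eq]; exact ZSpan.fundamentalDomain_measurableSet _

lemma quot_bound {d : ℕ} {F : EuclideanSpace ℝ (Fin d) → ℝ} (hF : ContDiff ℝ 1 F)
    (e : EuclideanSpace ℝ (Fin d)) :
    ∃ C : ℝ, ∀ x ∈ UnitCube d, ∀ t : ℝ, |t| ≤ 1 → ‖t⁻¹ • (F (x + t • e) - F x)‖ ≤ C := by
  obtain ⟨C, hC⟩ := (isCompact_closedBall (0 : EuclideanSpace ℝ (Fin d)) (d + ‖e‖)).exists_bound_of_continuousOn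
    (hF.continuous_fderiv one_ne_zero).continuousOn
  have hC0 : 0 ≤ C := (norm_nonneg _).trans (hC 0 (by simp; positivity))
  refine ⟨C * ‖e‖, fun x hx t ht => ?_⟩
  have hx' := cube_sub d hx
  simp only [Metric.mem_closedBall, dist_zero_right] at hx'
  have h1 : ‖t • e‖ ≤ ‖e‖ := by
    rw [norm_smul]; exact mul_le_of_le_one_left (norm_nonneg _) ht
  have := (convex_closedBall (0 : EuclideanSpace ℝ (Fin d)) (d + ‖e‖)).norm_image_sub_le_of_norm_fderiv_le
    (𝕜 := ℝ) (f := F) (C := C) (x := x) (y := x + t • e)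
    (fun y _ => (hF.differentiable one_ne_zero) y) hC
    (by simp only [Metric.mem_closedBall, dist_zero_right]; linarith [norm_nonneg e])
    (by simp only [Metric.mem_closedBall, dist_zero_right]; linarith [norm_add_le x (t • e)])
  rw [add_sub_cancel_left, norm_smul] at this
  rw [norm_smul, norm_inv]
  rcases eq_or_ne t 0 with rfl | h0
  · simp; positivity
  · have : 0 < ‖t‖ := norm_pos_iff.2 h0
    rw [inv_mul_le_iff₀ this]
    linarith

def tn (n : ℕ) : ℝ := 1 / ((n : ℝ) + 1)

lemma tn_pos (n : ℕ) : 0 < tn n := by unfold tn; positivity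
lemma tn_le (n : ℕ) : |tn n| ≤ 1 := by
  rw [abs_of_pos (tn_pos n)]; unfold tn
  rw [div_le_one (by positivity)]; linarith [(Nat.cast_nonneg n : (0 : ℝ) ≤ n)]
lemma tn_lim : Filter.Tendsto tn Filter.atTop (nhdsWithin 0 {0}ᶜ) := by
  rw [tendsto_nhdsWithin_iff]
  exact ⟨tendsto_one_div_add_atTop_nhds_zero_nat, Filter.Eventually.of_forall fun n => (tn_pos n).ne'⟩

lemma quot_lim {d : ℕ} {F : EuclideanSpace ℝ (Fin d) → ℝ} (hF : ContDiff ℝ 1 F)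
    (e x : EuclideanSpace ℝ (Fin d)) :
    Filter.Tendsto (fun n => (tn n)⁻¹ • (F (x + tn n • e) - F x)) Filter.atTop
      (nhds (fderiv ℝ F x e)) :=
  (((hF.differentiable one_ne_zero) x).hasFDerivAt.hasLineDerivAt e).tendsto_slope_zero.comp tn_lim

lemma int_deriv_zero {d : ℕ} {F : EuclideanSpace ℝ (Fin d) → ℝ} (hF : ContDiff ℝ 1 F)
    (hp : ZdPeriodic F) (e : EuclideanSpace ℝ (Fin d)) :
    ∫ x in UnitCube d, fderiv ℝ F x e = 0 := by
  obtain ⟨C, hC⟩ := quot_bound hF e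
  have hc := hF.continuous
  have h := tendsto_integral_of_dominated_convergence (μ := volume.restrict (UnitCube d))
    (F := fun n x => (tn n)⁻¹ • (F (x + tn n • e) - F x)) (f := fun x => fderiv ℝ F x e)
    (fun _ => C) (fun n => by
      have : Continuous (fun x => (tn n)⁻¹ • (F (x + tn n • e) - F x)) := by fun_prop
      exact this.aestronglyMeasurable)
    (integrableOn_const (cube_fin d).ne)
    (fun n => (ae_restrict_iff' (cube_meas d)).2 (Filter.Eventually.of_forall
      fun x hx => hC x hx _ (tn_le n)))
    (Filter.Eventually.of_forall fun x => quot_lim hF e x)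
  refine tendsto_nhds_unique h ?_
  have : ∀ n, ∫ x in UnitCube d, (tn n)⁻¹ • (F (x + tn n • e) - F x) = 0 := by
    intro n
    rw [integral_smul, integral_sub (cube_int (by fun_prop)) (cube_int hc), per_int_transl F hp]
    simp
  simp only [this]
  exact tendsto_const_nhds

lemma int_deriv_mul {d : ℕ} {F G : EuclideanSpace ℝ (Fin d) → ℝ} (hF : ContDiff ℝ 1 F)
    (hG : ContDiff ℝ 1 G) (e : EuclideanSpace ℝ (Fin d))
    (hle : ∀ t : ℝ, ∫ x in UnitCube d, (F (x + t • e) - F x) * (G (x + t • e) - G x) ≤ 0) :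
    ∫ x in UnitCube d, fderiv ℝ F x e * fderiv ℝ G x e ≤ 0 := by
  obtain ⟨C, hC⟩ := quot_bound hF e
  obtain ⟨C', hC'⟩ := quot_bound hG e
  have hc := hF.continuous
  have hc' := hG.continuous
  have h := tendsto_integral_of_dominated_convergence (μ := volume.restrict (UnitCube d))
    (F := fun n x => ((tn n)⁻¹ • (F (x + tn n • e) - F x)) * ((tn n)⁻¹ • (G (x + tn n • e) - G x)))
    (f := fun x => fderiv ℝ F x e * fderiv ℝ G x e)
    (fun _ => C * C') (fun n => by
      have : Continuous (fun x => ((tn n)⁻¹ • (F (x + tn n • e) - F x)) *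
        ((tn n)⁻¹ • (G (x + tn n • e) - G x))) := by fun_prop
      exact this.aestronglyMeasurable)
    (integrableOn_const (cube_fin d).ne)
    (fun n => (ae_restrict_iff' (cube_meas d)).2 (Filter.Eventually.of_forall
      fun x hx => by
        rw [norm_mul]
        have h1 := hC x hx _ (tn_le n)
        exact mul_le_mul h1 (hC' x hx _ (tn_le n)) (norm_nonneg _) ((norm_nonneg _).trans h1)))
    (Filter.Eventually.of_forall fun x => (quot_lim hF e x).mul (quot_lim hG e x))
  refine le_of_tendsto' h fun n => ?_
  have : ∀ x, ((tn n)⁻¹ • (F (x + tn n • e) - F x)) * ((tn n)⁻¹ • (G (x + tn n • e) - G x))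
      = ((tn n)⁻¹ * (tn n)⁻¹) * ((F (x + tn n • e) - F x) * (G (x + tn n • e) - G x)) := by
    intro x; simp only [smul_eq_mul]; ring
  simp only [this]
  rw [integral_const_mul]
  exact mul_nonpos_of_nonneg_of_nonpos (mul_self_nonneg _) (hle _)

lemma grad_apply {d : ℕ} (F : EuclideanSpace ℝ (Fin d) → ℝ) (x : EuclideanSpace ℝ (Fin d))
    (i : Fin d) : gradient F x i = fderiv ℝ F x (EuclideanSpace.single i 1) := by
  have : ⟪gradient F x, EuclideanSpace.single i (1 : ℝ)⟫ = fderiv ℝ F x (EuclideanSpace.single i 1) := by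
    exact InnerProductSpace.toDual_symm_apply
  rw [← this]
  rw [EuclideanSpace.inner_single_right]; simp

lemma grad_cont {d : ℕ} {F : EuclideanSpace ℝ (Fin d) → ℝ} (hF : ContDiff ℝ 1 F) :
    Continuous (gradient F) := by
  unfold gradient
  exact (LinearIsometryEquiv.continuous _).comp (hF.continuous_fderiv one_ne_zero)

lemma inner_eq_sum {d : ℕ} (a b : EuclideanSpace ℝ (Fin d)) : ⟪a, b⟫ = ∑ i, a i * b i := by
  simp [PiLp.inner_apply, mul_comm]

lemma fderiv_coord {d : ℕ} {w : EuclideanSpace ℝ (Fin d) → EuclideanSpace ℝ (Fin d)}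
    (hw : ContDiff ℝ 1 w) (x e : EuclideanSpace ℝ (Fin d)) (i : Fin d) :
    fderiv ℝ (fun y => w y i) x e = fderiv ℝ w x e i := by
  have h := ((EuclideanSpace.proj i : EuclideanSpace ℝ (Fin d) →L[ℝ] ℝ).hasFDerivAt (x := w x)).comp x
    ((hw.differentiable one_ne_zero) x).hasFDerivAt
  exact congrArg (fun L => L e) h.fderiv

lemma ibp {d : ℕ} {u : EuclideanSpace ℝ (Fin d) → ℝ}
    {w : EuclideanSpace ℝ (Fin d) → EuclideanSpace ℝ (Fin d)}
    (hu : ContDiff ℝ 1 u) (hw : ContDiff ℝ 1 w) (hup : ZdPeriodic u) (hwp : ZdPeriodic w) :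
    ∫ x in UnitCube d, ⟪w x, gradient u x⟫ = - ∫ x in UnitCube d, diverg w x * u x := by
  have hwi : ∀ i, ContDiff ℝ 1 (fun x => w x i) := fun i => contDiff_euclidean.1 hw i
  have hc : ∀ i, Continuous (fun x => fderiv ℝ (fun y => w y i * u y) x (EuclideanSpace.single i 1)) :=
    fun i => (((hwi i).mul hu).continuous_fderiv one_ne_zero).clm_apply continuous_const
  have h0 : ∫ x in UnitCube d, ∑ i, fderiv ℝ (fun y => w y i * u y) x (EuclideanSpace.single i 1) = 0 := by
    rw [integral_finsetSum _ (fun i _ => cube_int (hc i))]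
    apply Finset.sum_eq_zero
    intro i _
    apply int_deriv_zero ((hwi i).mul hu)
    intro x m
    simp only [hwp x m, hup x m]
  have hcd : Continuous (diverg w) := by
    unfold diverg
    refine continuous_finsetSum _ fun i _ => ?_
    simp only [← fderiv_coord hw]
    exact ((hwi i).continuous_fderiv one_ne_zero).clm_apply continuous_const
  have hcu := hu.continuous
  have hcw := hw.continuous
  have hcg := grad_cont hu
  have h1 : ∀ x, ∑ i, fderiv ℝ (fun y => w y i * u y) x (EuclideanSpace.single i 1)
      = ⟪w x, gradient u x⟫ + diverg w x * u x := by
    intro x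
    rw [inner_eq_sum, diverg, Finset.sum_mul, ← Finset.sum_add_distrib]
    refine Finset.sum_congr rfl fun i _ => ?_
    rw [fderiv_fun_mul ((hwi i).differentiable one_ne_zero x) (hu.differentiable one_ne_zero x)]
    simp only [add_apply, smul_apply, smul_eq_mul,
      fderiv_coord hw, grad_apply]
    ring
  simp only [h1] at h0
  rw [integral_add (cube_int (hcw.inner hcg)) (cube_int (F := fun x => diverg w x * u x) (hcd.mul hcu))] at h0
  linarith

lemma diverg_shift {d : ℕ} (z : EuclideanSpace ℝ (Fin d) → EuclideanSpace ℝ (Fin d))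
    (h x : EuclideanSpace ℝ (Fin d)) : diverg (fun y => z (y + h)) x = diverg z (x + h) := by
  simp only [diverg, fderiv_comp_add_right]

lemma per_shift {d : ℕ} {V : Type*} {f : EuclideanSpace ℝ (Fin d) → V} (hf : ZdPeriodic f)
    (h : EuclideanSpace ℝ (Fin d)) : ZdPeriodic (fun y => f (y + h)) := by
  intro x m
  change f _ = f _
  rw [add_right_comm, hf]

lemma diverg_contDiff {d : ℕ} {z : EuclideanSpace ℝ (Fin d) → EuclideanSpace ℝ (Fin d)}
    (hz : ContDiff ℝ 2 z) : ContDiff ℝ 1 (diverg z) := by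
  unfold diverg
  refine ContDiff.sum fun i _ => ?_
  have : ContDiff ℝ 1 (fun x => fderiv ℝ z x (EuclideanSpace.single i 1)) :=
    (hz.fderiv_right (by norm_num)).clm_apply contDiff_const
  exact contDiff_euclidean.1 this i

lemma diverg_per {d : ℕ} {z : EuclideanSpace ℝ (Fin d) → EuclideanSpace ℝ (Fin d)}
    (hz : ZdPeriodic z) : ZdPeriodic (diverg z) := by
  intro x m
  rw [← diverg_shift]
  congr 1
  funext y
  exact hz y m

/-- Lemma 2.3 in the smooth setting: if `|z| ≤ 1` and
`∫ |∇u| ≤ ∫ z · ∇u` (so that `-div z` belongs to the `L²` subdifferential of the total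
variation at `u`), then `∫ ∇u · ∇(div z) ≤ 0`. -/
theorem grad_inner_grad_div_nonpos (d : ℕ) (hd : 1 ≤ d)
    (u : EuclideanSpace ℝ (Fin d) → ℝ)
    (z : EuclideanSpace ℝ (Fin d) → EuclideanSpace ℝ (Fin d))
    (hu : ContDiff ℝ 1 u) (hz : ContDiff ℝ 2 z)
    (huper : ZdPeriodic u) (hzper : ZdPeriodic z)
    (hz1 : ∀ x, ‖z x‖ ≤ 1)
    (hcomp : ∫ x in UnitCube d, ‖gradient u x‖ ≤
      ∫ x in UnitCube d, ⟪z x, gradient u x⟫) :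
    ∫ x in UnitCube d, ⟪gradient u x, gradient (diverg z) x⟫ ≤ 0 := by
  have hf := diverg_contDiff hz
  have hfp := diverg_per hzper
  have hz' : ContDiff ℝ 1 z := hz.of_le (by norm_num)
  have hcf := hf.continuous
  have hcu := hu.continuous
  have hmin : ∀ h, ∫ x in UnitCube d, diverg z x * u x ≤
      ∫ x in UnitCube d, diverg z (x + h) * u x := by
    intro h
    have hzs : ContDiff ℝ 1 (fun y => z (y + h)) := hz'.comp (contDiff_id.add contDiff_const)
    have h1 := ibp hu hzs huper (per_shift hzper h)
    have h2 := ibp hu hz' huper hzper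
    simp only [diverg_shift] at h1
    have h3 : ∫ x in UnitCube d, ⟪z (x + h), gradient u x⟫ ≤
        ∫ x in UnitCube d, ‖gradient u x‖ := by
      refine integral_mono (cube_int (hzs.continuous.inner (grad_cont hu)))
        (cube_int (grad_cont hu).norm) fun x => ?_
      refine (real_inner_le_norm _ _).trans ?_
      exact mul_le_of_le_one_left (norm_nonneg _) (hz1 _)
    linarith
  have key : ∀ i, ∫ x in UnitCube d, fderiv ℝ u x (EuclideanSpace.single i 1) *
      fderiv ℝ (diverg z) x (EuclideanSpace.single i 1) ≤ 0 := by
    intro i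
    refine int_deriv_mul hu hf _ fun t => ?_
    set h := t • (EuclideanSpace.single i 1 : EuclideanSpace ℝ (Fin d)) with hh
    have e1 : ∫ x in UnitCube d, diverg z (x + h) * u (x + h) =
        ∫ x in UnitCube d, diverg z x * u x :=
      per_int_transl (fun x => diverg z x * u x)
        (fun x m => by simp only [hfp x m, huper x m]) h
    have e2 : ∫ x in UnitCube d, diverg z x * u (x + h) =
        ∫ x in UnitCube d, diverg z (x + -h) * u x := by
      rw [← per_int_transl (fun x => diverg z (x + -h) * u x)
        (fun x m => by simp only [per_shift hfp (-h) x m, huper x m]) h]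
      simp
    have e3 : ∀ x, (u (x + h) - u x) * (diverg z (x + h) - diverg z x) =
        (diverg z (x + h) * u (x + h) + diverg z x * u x) -
        (diverg z (x + h) * u x + diverg z x * u (x + h)) := by intro x; ring
    simp only [e3]
    rw [integral_sub (cube_int (by fun_prop)) (cube_int (by fun_prop)),
      integral_add (cube_int (by fun_prop)) (cube_int (by fun_prop)),
      integral_add (cube_int (by fun_prop)) (cube_int (by fun_prop)), e1, e2]
    linarith [hmin h, hmin (-h)]
  simp only [inner_eq_sum, grad_apply]
  rw [integral_finsetSum _ (fun i _ => cube_int (F := fun x =>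
    fderiv ℝ u x (EuclideanSpace.single i 1) * fderiv ℝ (diverg z) x (EuclideanSpace.single i 1))
    (((hu.continuous_fderiv one_ne_zero).clm_apply continuous_const).mul
      ((hf.continuous_fderiv one_ne_zero).clm_apply continuous_const)))]
  exact Finset.sum_nonpos fun i _ => key i

end
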